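/- Fix Δ, r ∈ ℤ with Δ ≥ 2 and r ≥ 2. Let G = (V, E) be a multihypergraph of maximum degree at most Δ and rank at most r, whose edge set is linearly ordered, with a finite-dimensional Hilbert space H_v = ℂ^{d_v} at each vertex and a unitary operator U_ε on H_ε = ⨂_{v∈ε} H_v assigned to each edge ε, regarded as acting on H_G = ⨂_{v∈V} H_v by tensoring with the identity. Suppose ‖U_ε − I‖ ≤ 1/(e³·Δ·C(r,2)) for all ε ∈ E, where ‖·‖ is the operator norm and C(r,2)=r(r−1)/2. Then the probability amplitude A_{U_G} = ⟨0^{|V|}| Π_{ε∈E} U_ε |0^{|V|}⟩ (product in the order of the edge labels) is nonzero. -/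

import Mathlib

open scoped Classical Matrix

namespace Stmt10

variable {V Eg : Type*}

/-- Configurations of the qudits in a subset `T` of the vertices: the index set of a
basis of `⨂_{v∈T} ℂ^{d_v}`. -/
abbrev Loc {V : Type*} (dim : V → ℕ) (T : Finset V) : Type _ := ∀ v : T, Fin (dim v)

/-- Configurations of all qudits: the index set of a basis of `H_G = ⨂_{v∈V} ℂ^{d_v}`. -/
abbrev Glob (dim : V → ℕ) : Type _ := ∀ v : V, Fin (dim v)

/-- The lift of an operator on `⨂_{v∈S} ℂ^{d_v}` to an operator on the full space
`H_G`, tensoring with the identity elsewhere. -/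
noncomputable def liftGlobal (dim : V → ℕ) (S : Finset V)
    (A : Matrix (Loc dim S) (Loc dim S) ℂ) : Matrix (Glob dim) (Glob dim) ℂ :=
  fun x y => (if ∀ v : V, v ∉ S → x v = y v then 1 else 0) *
    A (fun v => x v) (fun v => y v)

/-- The ordered product `Π_{ε ∈ S} f(ε)` of matrices, taken in the order of the edge
labels. -/
noncomputable def oprod [LinearOrder Eg] {n : Type*} [Fintype n] [DecidableEq n]
    (S : Finset Eg) (f : Eg → Matrix n n ℂ) : Matrix n n ℂ :=
  ((S.sort (· ≤ ·)).map f).prod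

/-- The degree of a vertex `v`: the number of edges containing `v`. -/
noncomputable def degree [Fintype Eg] (edge : Eg → Finset V) (v : V) : ℕ :=
  Nat.card {e : Eg // v ∈ edge e}

/-- The operator norm of a matrix, viewed as an operator on Euclidean space. -/
noncomputable def opNorm {n : Type*} [Fintype n] [DecidableEq n]
    (M : Matrix n n ℂ) : ℝ :=
  ‖Matrix.toEuclideanCLM (𝕜 := ℂ) M‖

theorem core_iter {E : Type*} [DecidableEq E] (Z : Finset E → ℂ) (κ : ℝ) (hκ : 1 ≤ κ) (n : ℕ)
    (hB : ∀ S : Finset E, S.card ≤ n → ∀ e ∈ S, ‖Z (S.erase e)‖ ≤ κ * ‖Z S‖) :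
    ∀ (k : ℕ) (S' S'' : Finset E), S'.card ≤ n → S'' ⊆ S' → (S' \ S'').card ≤ k →
      ‖Z S''‖ ≤ κ ^ k * ‖Z S'‖ := by
  intro k
  induction k with
  | zero =>
    intro S' S'' _ hs hk
    have h0 : S' \ S'' = ∅ := by simpa using hk
    have : S' = S'' := Finset.Subset.antisymm (Finset.sdiff_eq_empty_iff_subset.mp h0) hs
    simp [this]
  | succ k ih =>
    intro S' S'' hn hs hk
    by_cases h : S' \ S'' = ∅
    · have : S' = S'' := Finset.Subset.antisymm (Finset.sdiff_eq_empty_iff_subset.mp h) hs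
      rw [this]
      have : 1 ≤ κ ^ (k+1) := one_le_pow₀ hκ
      nlinarith [norm_nonneg (Z S'')]
    · obtain ⟨e, he⟩ := Finset.nonempty_iff_ne_empty.mpr h
      have he' := Finset.mem_sdiff.mp he
      have h1 := hB S' hn e he'.1
      have h2 : ‖Z S''‖ ≤ κ ^ k * ‖Z (S'.erase e)‖ := by
        apply ih
        · exact (Finset.card_erase_le).trans hn
        · intro x hx
          refine Finset.mem_erase.mpr ⟨?_, hs hx⟩
          rintro rfl
          exact he'.2 hx
        · have : (S'.erase e) \ S'' = (S' \ S'').erase e := by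
            ext x; simp only [Finset.mem_sdiff, Finset.mem_erase]; tauto
          rw [this, Finset.card_erase_of_mem he]
          omega
      calc ‖Z S''‖ ≤ κ ^ k * ‖Z (S'.erase e)‖ := h2
        _ ≤ κ ^ k * (κ * ‖Z S'‖) := by gcongr
        _ = _ := by ring

theorem core {E : Type*} [DecidableEq E] (adj : E → E → Prop) (Z : Finset E → Finset E → ℂ)
    (δ κ : ℝ) (D : ℕ) (hδ : 0 ≤ δ) (hκ : 1 ≤ κ)
    (hD : ∀ (e : E) (S : Finset E), (S.filter (fun s => adj e s)).card ≤ D)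
    (hmain : 1 ≤ κ * (1 - δ * κ ^ (2 * D)))
    (h1 : ∀ (T S : Finset E) (f : E), f ∈ S → f ∉ T →
      Z T S = Z T (S.erase f) + Z (insert f T) (S.erase f))
    (h2 : ∀ T S : Finset E, Disjoint T S → (∀ t ∈ T, ∀ s ∈ S, ¬ adj t s) →
      ‖Z T S‖ ≤ δ ^ T.card * ‖Z ∅ S‖)
    (h3 : Z ∅ ∅ = 1) (S : Finset E) : Z ∅ S ≠ 0 := by
  have hκ0 : 0 < κ := by linarith
  have hmain2 : 1 + δ * κ ^ (2 * D) ≤ κ := by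
    have hx : 0 ≤ δ * κ ^ (2 * D) := by positivity
    set x := δ * κ ^ (2 * D)
    have hx1 : x < 1 := by
      by_contra hh
      push Not at hh
      nlinarith
    nlinarith
  have key : ∀ n : ℕ,
      (∀ T S : Finset E, S.card < n → Disjoint T S →
        ‖Z T S‖ ≤ δ ^ T.card * κ ^ (S.filter (fun s => ∃ t ∈ T, adj t s)).card *
          ‖Z ∅ (S.filter (fun s => ¬ ∃ t ∈ T, adj t s))‖) ∧
      (∀ S : Finset E, S.card ≤ n → ∀ e ∈ S, ‖Z ∅ (S.erase e)‖ ≤ κ * ‖Z ∅ S‖) := by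
    intro n
    induction n with
    | zero =>
      refine ⟨fun T S h => by omega, fun S h e he => ?_⟩
      have : S = ∅ := by simpa using h
      simp [this] at he
    | succ n ih =>
      obtain ⟨ihA, ihB⟩ := ih
      have hA : (∀ T S : Finset E, S.card < n + 1 → Disjoint T S →
        ‖Z T S‖ ≤ δ ^ T.card * κ ^ (S.filter (fun s => ∃ t ∈ T, adj t s)).card *
          ‖Z ∅ (S.filter (fun s => ¬ ∃ t ∈ T, adj t s))‖) := by
        intro T S hS hd
        by_cases hne : ∃ f ∈ S, ∃ t ∈ T, adj t f
        · obtain ⟨f, hf, hfT⟩ := hne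
          have hfn : f ∉ T := fun h => Finset.disjoint_left.mp hd h hf
          have hc : (S.erase f).card < n := by
            rw [Finset.card_erase_of_mem hf]
            have := Finset.card_pos.mpr ⟨f, hf⟩
            omega
          have hfar : (S.erase f).filter (fun s => ¬ ∃ t ∈ T, adj t s)
              = S.filter (fun s => ¬ ∃ t ∈ T, adj t s) := by
            ext x; simp only [Finset.mem_filter, Finset.mem_erase]
            constructor
            · tauto
            · rintro ⟨a, b⟩
              refine ⟨⟨?_, a⟩, b⟩
              rintro rfl
              exact b hfT
          have hnear : (S.erase f).filter (fun s => ∃ t ∈ T, adj t s)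
              = (S.filter (fun s => ∃ t ∈ T, adj t s)).erase f := by
            ext x; simp only [Finset.mem_filter, Finset.mem_erase]; tauto
          have hfm : f ∈ S.filter (fun s => ∃ t ∈ T, adj t s) :=
            Finset.mem_filter.mpr ⟨hf, hfT⟩
          obtain ⟨m, hm⟩ : ∃ m, (S.filter (fun s => ∃ t ∈ T, adj t s)).card = m + 1 :=
            Nat.exists_eq_succ_of_ne_zero (Finset.card_pos.mpr ⟨f, hfm⟩).ne'
          have hnearc : ((S.erase f).filter (fun s => ∃ t ∈ T, adj t s)).card = m := by
            rw [hnear, Finset.card_erase_of_mem hfm, hm]; rfl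
          have b1 := ihA T (S.erase f) hc
            (hd.mono_right (Finset.erase_subset _ _))
          have b2 := ihA (insert f T) (S.erase f) hc (by
            rw [Finset.disjoint_insert_left]
            exact ⟨Finset.notMem_erase _ _, hd.mono_right (Finset.erase_subset _ _)⟩)
          rw [hfar, hnearc] at b1
          set S' := S.filter (fun s => ¬ ∃ t ∈ T, adj t s) with hS'
          have hcard : ((S.erase f).filter (fun s => ∃ t ∈ insert f T, adj t s)).card ≤ m + D := by
            refine le_trans (Finset.card_le_card (t := (S.erase f).filter
              (fun s => ∃ t ∈ T, adj t s) ∪ S.filter (fun s => adj f s)) ?_) ?_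
            · intro x
              simp only [Finset.mem_filter, Finset.mem_union, Finset.mem_erase,
                Finset.mem_insert]
              rintro ⟨⟨a, b⟩, t, rfl | ht, h⟩
              · exact Or.inr ⟨b, h⟩
              · exact Or.inl ⟨⟨a, b⟩, t, ht, h⟩
            · refine (Finset.card_union_le _ _).trans ?_
              rw [hnearc]
              exact Nat.add_le_add_left (hD f S) m
          have b3 : ‖Z ∅ ((S.erase f).filter (fun s => ¬ ∃ t ∈ insert f T, adj t s))‖
              ≤ κ ^ D * ‖Z ∅ S'‖ := by
            apply core_iter (Z ∅) κ hκ n ihB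
            · rw [← hfar]
              exact (Finset.card_filter_le _ _).trans hc.le
            · rw [← hfar]
              intro x
              simp only [Finset.mem_filter, Finset.mem_insert]
              rintro ⟨a, b⟩
              exact ⟨a, fun ⟨t, ht, h⟩ => b ⟨t, Or.inr ht, h⟩⟩
            · refine le_trans (Finset.card_le_card (t := S.filter (fun s => adj f s)) ?_) (hD f S)
              rw [← hfar]
              intro x
              simp only [Finset.mem_sdiff, Finset.mem_filter, Finset.mem_insert, Finset.mem_erase]
              rintro ⟨⟨⟨a, b⟩, c⟩, d⟩
              refine ⟨b, ?_⟩
              by_contra hh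
              apply d
              refine ⟨⟨a, b⟩, ?_⟩
              rintro ⟨t, rfl | ht, h⟩
              · exact hh h
              · exact c ⟨t, ht, h⟩
          have b4 : ‖Z (insert f T) (S.erase f)‖
              ≤ δ ^ (T.card + 1) * κ ^ (m + D) * (κ ^ D * ‖Z ∅ S'‖) := by
            refine b2.trans ?_
            rw [Finset.card_insert_of_notMem hfn]
            gcongr
          rw [h1 T S f hf hfn, hm]
          calc _ ≤ ‖Z T (S.erase f)‖ + ‖Z (insert f T) (S.erase f)‖ := norm_add_le _ _
            _ ≤ δ ^ T.card * κ ^ m * ‖Z ∅ S'‖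
                + δ ^ (T.card + 1) * κ ^ (m + D) * (κ ^ D * ‖Z ∅ S'‖) := add_le_add b1 b4
            _ = (δ ^ T.card * κ ^ m * ‖Z ∅ S'‖) * (1 + δ * κ ^ (2 * D)) := by ring
            _ ≤ (δ ^ T.card * κ ^ m * ‖Z ∅ S'‖) * κ := by gcongr
            _ = _ := by ring
        · have hn : S.filter (fun s => ∃ t ∈ T, adj t s) = ∅ := by
            apply Finset.filter_false_of_mem
            intro x hx h
            exact hne ⟨x, hx, h⟩
          have hf : S.filter (fun s => ¬ ∃ t ∈ T, adj t s) = S := by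
            apply Finset.filter_true_of_mem
            intro x hx h
            exact hne ⟨x, hx, h⟩
          rw [hn, hf]
          simpa using h2 T S hd (fun t ht s hs h => hne ⟨s, hs, t, ht, h⟩)
      refine ⟨hA, ?_⟩
      intro S hS e he
      have hc : (S.erase e).card < n + 1 := by
        rw [Finset.card_erase_of_mem he]
        have := Finset.card_pos.mpr ⟨e, he⟩
        omega
      have b1 := hA {e} (S.erase e) hc (by simp)
      have e1 := h1 ∅ S e he (by simp)
      have b3 : ‖Z ∅ ((S.erase e).filter (fun s => ¬ ∃ t ∈ ({e} : Finset E), adj t s))‖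
              ≤ κ ^ D * ‖Z ∅ (S.erase e)‖ := by
        apply core_iter (Z ∅) κ hκ n ihB
        · omega
        · exact Finset.filter_subset _ _
        · refine le_trans (Finset.card_le_card (t := S.filter (fun s => adj e s)) ?_) (hD e S)
          intro x
          simp only [Finset.mem_sdiff, Finset.mem_filter, Finset.mem_erase, Finset.mem_singleton,
            exists_eq_left]
          tauto
      have hcard : ((S.erase e).filter (fun s => ∃ t ∈ ({e} : Finset E), adj t s)).card ≤ D := by
        simpa using hD e (S.erase e)
      have b4 : ‖Z {e} (S.erase e)‖ ≤ δ ^ 1 * κ ^ D * (κ ^ D * ‖Z ∅ (S.erase e)‖) := by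
        refine b1.trans ?_
        rw [Finset.card_singleton]
        gcongr
      have e2 : Z ∅ (S.erase e) = Z ∅ S - Z {e} (S.erase e) := by
        rw [e1]; simp
      have b5 : ‖Z ∅ (S.erase e)‖ * (1 - δ * κ ^ (2 * D)) ≤ ‖Z ∅ S‖ := by
        have := norm_sub_le (Z ∅ S) (Z {e} (S.erase e))
        rw [← e2] at this
        have e3 : δ ^ 1 * κ ^ D * (κ ^ D * ‖Z ∅ (S.erase e)‖)
          = ‖Z ∅ (S.erase e)‖ * (δ * κ ^ (2 * D)) := by ring
        linarith
      calc ‖Z ∅ (S.erase e)‖ ≤ ‖Z ∅ (S.erase e)‖ * (κ * (1 - δ * κ ^ (2 * D))) :=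
            le_mul_of_one_le_right (norm_nonneg _) hmain
        _ = κ * (‖Z ∅ (S.erase e)‖ * (1 - δ * κ ^ (2 * D))) := by ring
        _ ≤ κ * ‖Z ∅ S‖ := by gcongr
  have := core_iter (Z ∅) κ hκ S.card (key S.card).2 S.card S ∅ le_rfl (by simp) (by simp)
  intro h
  rw [h, h3] at this
  simp at this
  linarith

theorem prod_split {E M : Type*} [Ring M] (l : List E) (hl : l.Nodup) (a : E) (ha : a ∈ l)
    (f g h : E → M) (hg : ∀ x, x ≠ a → f x = g x) (hh : ∀ x, x ≠ a → f x = h x)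
    (hs : f a = g a + h a) : (l.map f).prod = (l.map g).prod + (l.map h).prod := by
  induction l with
  | nil => simp at ha
  | cons b l ih =>
    rw [List.nodup_cons] at hl
    simp only [List.map_cons, List.prod_cons]
    by_cases hb : b = a
    · subst hb
      have e1 : l.map f = l.map g := List.map_congr_left (fun x hx => hg x (by
        rintro rfl; exact hl.1 hx))
      have e2 : l.map f = l.map h := List.map_congr_left (fun x hx => hh x (by
        rintro rfl; exact hl.1 hx))
      rw [← e1, ← e2, hs, add_mul]
    · have : a ∈ l := by
        rcases List.mem_cons.mp ha with h | h
        · exact absurd h.symm hb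
        · exact h
      rw [ih hl.2 this, ← hg b hb, ← hh b hb, mul_add]

theorem prod_comm_mul {E M : Type*} [Ring M] (l : List E) (g h : E → M)
    (hc : ∀ a b, Commute (h a) (g b)) :
    (l.map (fun x => g x * h x)).prod = (l.map g).prod * (l.map h).prod := by
  induction l with
  | nil => simp
  | cons b l ih =>
    simp only [List.map_cons, List.prod_cons]
    rw [ih]
    have : Commute (h b) (l.map g).prod := by
      apply Commute.list_prod_right
      intro x hx
      obtain ⟨y, _, rfl⟩ := List.mem_map.mp hx
      exact hc b y
    calc g b * h b * ((l.map g).prod * (l.map h).prod)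
        = g b * (h b * (l.map g).prod) * (l.map h).prod := by simp only [mul_assoc]
      _ = _ := by rw [this.eq]; simp only [mul_assoc]

/-- Only acts nontrivially on `X`. -/
def Act (dim : V → ℕ) (X : Set V) (M : Matrix (Glob dim) (Glob dim) ℂ) : Prop :=
  ∀ x y, M x y ≠ 0 → ∀ v, v ∉ X → x v = y v

theorem act_one [DecidableEq V] [Fintype V] (dim : V → ℕ) (X : Set V) :
    Act dim X (1 : Matrix (Glob dim) (Glob dim) ℂ) := by
  intro x y h v _
  by_contra hh
  apply h
  rw [Matrix.one_apply_ne]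
  rintro rfl
  exact hh rfl

theorem act_lift (dim : V → ℕ) (X : Set V) (S : Finset V) (hS : (S : Set V) ⊆ X)
    (A : Matrix (Loc dim S) (Loc dim S) ℂ) : Act dim X (liftGlobal dim S A) := by
  intro x y h v hv
  unfold liftGlobal at h
  split_ifs at h with h'
  · exact h' v (fun hs => hv (hS hs))
  · simp at h

theorem act_mul [DecidableEq V] [Fintype V] (dim : V → ℕ) (X : Set V)
    (M N : Matrix (Glob dim) (Glob dim) ℂ) (hM : Act dim X M) (hN : Act dim X N) :
    Act dim X (M * N) := by
  intro x y h v hv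
  rw [Matrix.mul_apply] at h
  obtain ⟨z, _, hz⟩ := Finset.exists_ne_zero_of_sum_ne_zero h
  exact (hM x z (left_ne_zero_of_mul hz) v hv).trans (hN z y (right_ne_zero_of_mul hz) v hv)

theorem act_prod [DecidableEq V] [Fintype V] (dim : V → ℕ) (X : Set V) (l : List Eg)
    (f : Eg → Matrix (Glob dim) (Glob dim) ℂ) (hf : ∀ e, Act dim X (f e)) :
    Act dim X (l.map f).prod := by
  induction l with
  | nil => simpa using act_one dim X
  | cons b l ih => simpa using act_mul dim X _ _ (hf b) ih

theorem act_factor [DecidableEq V] [Fintype V] (dim : V → ℕ) (X : Set V)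
    (M N : Matrix (Glob dim) (Glob dim) ℂ) (hM : Act dim X M) (hN : Act dim Xᶜ N) (x : Glob dim) :
    (M * N) x x = M x x * N x x := by
  rw [Matrix.mul_apply]
  apply Finset.sum_eq_single x
  · intro z _ hz
    by_contra h
    apply hz
    funext v
    by_cases hv : v ∈ X
    · exact hN z x (right_ne_zero_of_mul h) v (by simpa using hv)
    · exact (hM x z (left_ne_zero_of_mul h) v hv).symm
  · simp

theorem lift_eq_kron [DecidableEq V] [Fintype V] (dim : V → ℕ) (S : Finset V)
    (A : Matrix (Loc dim S) (Loc dim S) ℂ) :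
    liftGlobal dim S A =
      (Matrix.kronecker A (1 : Matrix (∀ v : {v // v ∉ S}, Fin (dim v)) _ ℂ)).submatrix
        (Equiv.piEquivPiSubtypeProd (fun v => v ∈ S) (fun v => Fin (dim v)))
        (Equiv.piEquivPiSubtypeProd (fun v => v ∈ S) (fun v => Fin (dim v))) := by
  ext x y
  simp only [liftGlobal, Matrix.submatrix_apply, Matrix.kronecker, Matrix.kroneckerMap_apply,
    Equiv.piEquivPiSubtypeProd_apply, Matrix.one_apply]
  rw [mul_comm]
  congr 1
  simp only [funext_iff, Subtype.forall]
  congr 1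

theorem lift_mul [DecidableEq V] [Fintype V] (dim : V → ℕ) (S : Finset V)
    (A B : Matrix (Loc dim S) (Loc dim S) ℂ) :
    liftGlobal dim S (A * B) = liftGlobal dim S A * liftGlobal dim S B := by
  simp only [lift_eq_kron]
  rw [Matrix.submatrix_mul_equiv]
  congr 1
  have := Matrix.mul_kronecker_mul A B (1 : Matrix (∀ v : {v // v ∉ S}, Fin (dim v)) (∀ v : {v // v ∉ S}, Fin (dim v)) ℂ)
    (1 : Matrix (∀ v : {v // v ∉ S}, Fin (dim v)) (∀ v : {v // v ∉ S}, Fin (dim v)) ℂ)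
  simpa using this

theorem lift_one [DecidableEq V] [Fintype V] (dim : V → ℕ) (S : Finset V) :
    liftGlobal dim S (1 : Matrix (Loc dim S) (Loc dim S) ℂ) = 1 := by
  simp only [lift_eq_kron]
  simp [Matrix.kronecker]

theorem lift_sub (dim : V → ℕ) (S : Finset V)
    (A B : Matrix (Loc dim S) (Loc dim S) ℂ) :
    liftGlobal dim S (A - B) = liftGlobal dim S A - liftGlobal dim S B := by
  ext x y
  simp [liftGlobal, mul_sub]

theorem lift_star (dim : V → ℕ) (S : Finset V)
    (A : Matrix (Loc dim S) (Loc dim S) ℂ) :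
    liftGlobal dim S (Aᴴ) = (liftGlobal dim S A)ᴴ := by
  ext x y
  simp only [liftGlobal, Matrix.conjTranspose_apply, star_mul']
  congr 1
  have : (∀ v : V, v ∉ S → x v = y v) ↔ (∀ v : V, v ∉ S → y v = x v) := by
    constructor <;> exact fun h v hv => (h v hv).symm
  simp only [this]
  split_ifs <;> simp

open scoped Matrix.Norms.L2Operator in
theorem opNorm_eq {n : Type*} [Fintype n] [DecidableEq n] (M : Matrix n n ℂ) :
    opNorm M = ‖M‖ := rfl

open scoped Matrix.Norms.L2Operator in
theorem lift_norm [DecidableEq V] [Fintype V] (dim : V → ℕ) (S : Finset V)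
    (A : Matrix (Loc dim S) (Loc dim S) ℂ) : opNorm (liftGlobal dim S A) ≤ opNorm A := by
  rw [opNorm_eq, opNorm_eq]
  let φ : Matrix (Loc dim S) (Loc dim S) ℂ →⋆ₙₐ[ℂ] Matrix (Glob dim) (Glob dim) ℂ :=
    { toFun := liftGlobal dim S
      map_smul' := by intro c M; ext x y; simp [liftGlobal]
      map_zero' := by ext x y; simp [liftGlobal]
      map_add' := by intro M N; ext x y; simp [liftGlobal, mul_add]
      map_mul' := lift_mul dim S
      map_star' := lift_star dim S }
  let _ : CStarAlgebra (Matrix (Loc dim S) (Loc dim S) ℂ) := {}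
  let _ : CStarAlgebra (Matrix (Glob dim) (Glob dim) ℂ) := {}
  exact NonUnitalStarAlgHom.norm_apply_le φ A

open scoped Matrix.Norms.L2Operator in
theorem prod_entry_le {n : Type*} [Fintype n] [DecidableEq n] (l : List Eg) (hl : l.Nodup)
    (T : Finset Eg) (hT : ∀ t ∈ T, t ∈ l)
    (f : Eg → Matrix n n ℂ) (δ : ℝ) (hδ : 0 ≤ δ) (h1 : ∀ e ∉ T, f e = 1)
    (h2 : ∀ e ∈ T, opNorm (f e) ≤ δ) (x : n) :
    ‖((l.map f).prod) x x‖ ≤ δ ^ T.card := by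
  have key : ∀ l : List Eg, ‖(l.map f).prod‖ ≤ δ ^ (l.countP (· ∈ T)) := by
    intro l
    induction l with
    | nil =>
      have : Nonempty n := ⟨x⟩
      simp
    | cons b l ih =>
      simp only [List.map_cons, List.prod_cons]
      by_cases hb : b ∈ T
      · rw [List.countP_cons_of_pos (by simpa using hb), pow_succ']
        exact (norm_mul_le _ _).trans (mul_le_mul (h2 b hb) ih (norm_nonneg _) hδ)
      · rw [List.countP_cons_of_neg (by simpa using hb), h1 b hb, one_mul]
        exact ih
  have hc : l.countP (· ∈ T) = T.card := by
    rw [List.countP_eq_length_filter, ← List.toFinset_card_of_nodup (hl.filter _)]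
    congr 1
    ext t
    simp only [List.mem_toFinset, List.mem_filter, decide_eq_true_eq]
    exact ⟨fun h => h.2, fun h => ⟨hT t h, h⟩⟩
  rw [← hc]
  refine le_trans ?_ (key l)
  have := Matrix.l2_opNorm_mulVec ((l.map f).prod) (EuclideanSpace.single x (1:ℂ))
  simp at this
  refine le_trans ?_ this
  refine le_trans ?_ (PiLp.norm_apply_le _ x)
  simp

theorem lift_commute [DecidableEq V] [Fintype V] (dim : V → ℕ) (S T : Finset V)
    (hST : Disjoint S T)
    (A : Matrix (Loc dim S) (Loc dim S) ℂ) (B : Matrix (Loc dim T) (Loc dim T) ℂ) :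
    liftGlobal dim S A * liftGlobal dim T B = liftGlobal dim T B * liftGlobal dim S A := by
  have key : ∀ (S T : Finset V) (hST : Disjoint S T)
      (A : Matrix (Loc dim S) (Loc dim S) ℂ) (B : Matrix (Loc dim T) (Loc dim T) ℂ)
      (x y : Glob dim), (liftGlobal dim S A * liftGlobal dim T B) x y =
      (if ∀ v, v ∉ S → v ∉ T → x v = y v then 1 else 0) *
        (A (fun v => x v) (fun v => y v) * B (fun v => x v) (fun v => y v)) := by
    intro S T hST A B x y
    rw [Matrix.mul_apply]
    rw [Finset.sum_eq_single (fun v => if v ∈ S then y v else x v)]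
    · have e1 : (fun v : T => (if (v : V) ∈ S then y v else x v)) = fun v : T => x v := by
        funext v
        rw [if_neg (Finset.disjoint_right.mp hST v.2)]
      have e2 : (fun v : S => (if (v : V) ∈ S then y v else x v)) = fun v : S => y v := by
        funext v
        rw [if_pos v.2]
      have e3 : (∀ v, v ∉ S → x v = if v ∈ S then y v else x v) := by
        intro v hv; rw [if_neg hv]
      have e4 : (∀ v, v ∉ T → (if v ∈ S then y v else x v) = y v) ↔
          (∀ v, v ∉ S → v ∉ T → x v = y v) := by
        refine forall_congr' fun v => ?_
        by_cases hv : v ∈ S <;> simp [hv]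
      simp only [liftGlobal, e1, e2]
      rw [if_pos e3]
      simp only [e4]
      ring
    · intro z _ hz
      by_contra h
      apply hz
      funext v
      have a1 := act_lift dim S S subset_rfl A x z (left_ne_zero_of_mul h) v
      have a2 := act_lift dim T T subset_rfl B z y (right_ne_zero_of_mul h) v
      split_ifs with hv
      · exact a2 (by simpa using Finset.disjoint_left.mp hST hv)
      · exact (a1 (by simpa using hv)).symm
    · simp
  ext x y
  rw [key S T hST A B, key T S hST.symm B A]
  have : (∀ v, v ∉ S → v ∉ T → x v = y v) ↔ (∀ v, v ∉ T → v ∉ S → x v = y v) := by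
    constructor <;> exact fun h v a b => h v b a
  simp only [this]
  rw [mul_comm (A _ _)]

/-- **Theorem 5 of the paper (zero freeness part).** Let `G` be a multihypergraph of
maximum degree at most `Δ` and rank at most `r` (with `Δ, r ≥ 2`), with a unitary
`U_ε` on `H_ε` for each edge satisfying `‖U_ε − I‖ ≤ 1/(e³·Δ·C(r,2))`.  Then the
probability amplitude `A_{U_G} = ⟨0^{|V|}| Π_{ε∈E} U_ε |0^{|V|}⟩` is nonzero. -/
theorem amplitude_ne_zero [DecidableEq V] [Fintype V] [LinearOrder Eg] [Fintype Eg]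
    (Δ r : ℤ) (hΔ : 2 ≤ Δ) (hr : 2 ≤ r)
    (edge : Eg → Finset V) (hne : ∀ e : Eg, (edge e).Nonempty)
    (hdeg : ∀ v : V, (degree edge v : ℤ) ≤ Δ)
    (hrank : ∀ e : Eg, ((edge e).card : ℤ) ≤ r)
    (dim : V → ℕ) (hd : ∀ v, 0 < dim v)
    (A : ∀ e : Eg, Matrix (Loc dim (edge e)) (Loc dim (edge e)) ℂ)
    (hunitary : ∀ e : Eg, (A e)ᴴ * A e = 1)
    (hnorm : ∀ e : Eg,
      opNorm (A e - 1) ≤ 1 / (Real.exp 1 ^ 3 * Δ * ((r : ℝ) * (r - 1) / 2))) :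
    (oprod Finset.univ (fun e => liftGlobal dim (edge e) (A e)))
        (fun v => ⟨0, hd v⟩) (fun v => ⟨0, hd v⟩) ≠ 0 := by
  set D : ℕ := (r * Δ).toNat with hDdef
  have hDz : (D : ℤ) = r * Δ := Int.toNat_of_nonneg (by positivity)
  have hDr : (D : ℝ) = (r : ℝ) * Δ := by exact_mod_cast hDz
  have hr' : (2 : ℝ) ≤ r := by exact_mod_cast hr
  have hΔ' : (2 : ℝ) ≤ Δ := by exact_mod_cast hΔ
  have hD4 : (4 : ℝ) ≤ D := by rw [hDr]; nlinarith
  set δ : ℝ := 1 / (8 * D) with hδdef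
  have hδ : 0 ≤ δ := by positivity
  have hnorm' : ∀ e, opNorm (A e - 1) ≤ δ := by
    intro e
    refine (hnorm e).trans ?_
    rw [hδdef, hDr]
    have he : (16 : ℝ) ≤ Real.exp 1 ^ 3 := by
      have h27 : (2.7 : ℝ) ≤ Real.exp 1 := by linarith [Real.exp_one_gt_d9]
      calc (16 : ℝ) ≤ 2.7 ^ 3 := by norm_num
        _ ≤ _ := by gcongr
    apply one_div_le_one_div_of_le (by positivity)
    have h1 : (r : ℝ) / 2 ≤ (r : ℝ) * (r - 1) / 2 := by nlinarith
    calc 8 * ((r : ℝ) * Δ) = 16 * Δ * (r / 2) := by ring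
      _ ≤ _ := by gcongr
  set β : ℝ := 1 / (4 * D) with hβ
  have hβ1 : β ≤ 1 / 16 := by
    rw [hβ]; apply one_div_le_one_div_of_le <;> linarith
  have hβ0 : 0 < β := by positivity
  have hmain : 1 ≤ (1 - β)⁻¹ * (1 - δ * ((1 - β)⁻¹) ^ (2 * D)) := by
    have hbern : 1 / 2 ≤ (1 - β) ^ (2 * D) := by
      have := one_add_mul_le_pow (a := -β) (by linarith) (2 * D)
      rw [← sub_eq_add_neg] at this
      refine le_trans (le_of_eq ?_) this
      rw [hβ]; push_cast; field_simp; norm_num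
    have h2 : ((1 - β)⁻¹) ^ (2 * D) ≤ 2 := by
      rw [inv_pow]
      have := inv_anti₀ (by norm_num) hbern
      simpa using this
    have h3 : δ * ((1 - β)⁻¹) ^ (2 * D) ≤ β := by
      calc _ ≤ δ * 2 := by gcongr
        _ = β := by rw [hδdef, hβ]; field_simp; norm_num
    have hp : 0 < 1 - β := by linarith
    calc (1 : ℝ) = (1 - β)⁻¹ * (1 - β) := by field_simp
      _ ≤ _ := by gcongr
  have hκ : 1 ≤ (1 - β)⁻¹ := (one_le_inv₀ (by linarith)).mpr (by linarith)
  set L : List Eg := Finset.univ.sort (· ≤ ·) with hL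
  have hLn : L.Nodup := Finset.sort_nodup _ _
  have hLm : ∀ e, e ∈ L := fun e => by simp [hL]
  let F : Finset Eg → Finset Eg → Eg → Matrix (Glob dim) (Glob dim) ℂ := fun T S e =>
    if e ∈ T then liftGlobal dim (edge e) (A e - 1)
    else if e ∈ S then liftGlobal dim (edge e) (A e) else 1
  have hF : (fun e => liftGlobal dim (edge e) (A e)) = F ∅ Finset.univ := by
    funext e; simp [F]
  have := core (fun e f : Eg => ¬ Disjoint (edge e) (edge f))
    (fun T S => ((L.map (F T S)).prod) (fun v => ⟨0, hd v⟩) (fun v => ⟨0, hd v⟩))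
    δ (1 - β)⁻¹ D hδ hκ ?_ hmain ?_ ?_ ?_ Finset.univ
  · unfold oprod
    rw [hF]
    exact this
  · intro e S
    refine (Finset.card_le_card
      (t := (edge e).biUnion (fun v => Finset.univ.filter (fun f => v ∈ edge f))) ?_).trans ?_
    · intro f
      simp only [Finset.mem_filter, Finset.mem_biUnion, Finset.mem_univ, true_and,
        Finset.not_disjoint_iff]
      exact fun h => h.2
    have hdeg' : ∀ v ∈ edge e, (Finset.univ.filter (fun f => v ∈ edge f)).card ≤ Δ.toNat := by
      intro v _
      have := hdeg v
      unfold degree at this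
      rw [Nat.card_eq_fintype_card, Fintype.card_subtype] at this
      omega
    have h1 := (Finset.card_biUnion_le_card_mul _ _ _ hdeg')
    refine h1.trans ?_
    zify
    rw [hDz, Int.toNat_of_nonneg (by omega)]
    exact mul_le_mul_of_nonneg_right (hrank e) (by omega)
  · intro T S f hfS hfT
    have := prod_split L hLn f (hLm f) (F T S) (F T (S.erase f)) (F (insert f T) (S.erase f))
      (by intro x hx; simp [F, hx]) (by intro x hx; simp [F, hx])
      (by simp [F, hfS, hfT, lift_sub, lift_one])
    simp only [this, Matrix.add_apply]
  · intro T S hTS hadj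
    have hfac : F T S = fun e => F T ∅ e * F ∅ S e := by
      funext e
      by_cases heT : e ∈ T
      · have : e ∉ S := Finset.disjoint_left.mp hTS heT
        simp [F, heT, this]
      · simp [F, heT]
    have hcomm : ∀ a b, Commute (F ∅ S a) (F T ∅ b) := by
      intro a b
      by_cases ha : a ∈ S
      · by_cases hb : b ∈ T
        · simp only [F, ha, hb, if_true, Finset.notMem_empty, if_false]
          have := hadj b hb a ha
          rw [not_not] at this
          exact lift_commute dim _ _ this.symm _ _
        · simp [F, hb]
      · simp [F, ha]
    let X : Set V := {v | ∃ t ∈ T, v ∈ edge t}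
    have hM : Act dim X (L.map (F T ∅)).prod := by
      apply act_prod
      intro e
      by_cases he : e ∈ T
      · simp only [F, he, if_true]
        exact act_lift _ _ _ (show (edge e : Set V) ⊆ X from fun v hv => ⟨e, he, hv⟩) _
      · simpa [F, he] using act_one dim X
    have hN : Act dim Xᶜ (L.map (F ∅ S)).prod := by
      apply act_prod
      intro e
      by_cases he : e ∈ S
      · simp only [F, he, if_true, Finset.notMem_empty, if_false]
        refine act_lift _ _ _ ?_ _
        rintro v hv ⟨t, ht, hvt⟩
        have := hadj t ht e he
        rw [not_not] at this
        exact Finset.disjoint_left.mp this hvt hv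
      · simpa [F, he] using act_one dim Xᶜ
    change ‖(L.map (F T S)).prod (fun v => ⟨0, hd v⟩) (fun v => ⟨0, hd v⟩)‖ ≤
      δ ^ T.card * ‖(L.map (F ∅ S)).prod (fun v => ⟨0, hd v⟩) (fun v => ⟨0, hd v⟩)‖
    rw [hfac, prod_comm_mul L _ _ hcomm, act_factor dim X _ _ hM hN, norm_mul]
    apply mul_le_mul_of_nonneg_right _ (norm_nonneg _)
    apply prod_entry_le L hLn T (fun t _ => hLm t) _ δ hδ
    · intro e he; simp [F, he]
    · intro e he
      simp only [F, he, if_true]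
      exact (lift_norm _ _ _).trans (hnorm' e)
  · have : F ∅ ∅ = fun _ => 1 := by funext e; simp [F]
    simp [this]

end Stmt10
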